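/- In the setting of the previous statement (N ≥ 2, 0<q,t<1, b<0<a, c=conj(d)∉ℝ), the constant term of D_N e_{2,N}, where e_{2,N} = Σ_{i<j} x_i x_j, equals -C_N(q,t)(t^{1-N} - 1) with C_N(q,t) = (q t^{N-1}/(a|b|))(1-q)(1-t^N)/(1-t); in particular it is strictly negative. -/

import Mathlib

open Finset

/-- Vandermonde product `∏_{i<j} (x_i - x_j)`. -/
noncomputable def bqjVandermonde (N : ℕ) (x : Fin N → ℂ) : ℂ :=
  ∏ i : Fin N, ∏ j ∈ Finset.Ioi i, (x i - x j)

/-- `σ⁺_N(x) = -(q t^{N-1}/(ab)) (c - 1/x)(d - 1/x)`. -/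
noncomputable def bqjSigmaPlusN (N : ℕ) (q t a b : ℝ) (c d : ℂ) (x : ℂ) : ℂ :=
  (t : ℂ) ^ ((N : ℤ) - 1) * (-((q : ℂ)/((a : ℂ)*(b : ℂ))) * (c - x⁻¹) * (d - x⁻¹))

/-- `σ⁻_N(x) = -(q² t^{N-1}/(ab)) (a/q - 1/x)(b/q - 1/x)`. -/
noncomputable def bqjSigmaMinusN (N : ℕ) (q t a b : ℝ) (x : ℂ) : ℂ :=
  (t : ℂ) ^ ((N : ℤ) - 1) *
    (-((q : ℂ)^2/((a : ℂ)*(b : ℂ))) * ((a : ℂ)/(q : ℂ) - x⁻¹) * ((b : ℂ)/(q : ℂ) - x⁻¹))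

/-- The `N`-variable big q-Jacobi q-difference operator `D_N`, applied to a function
`f` of `N` complex variables, at the point `x`. -/
noncomputable def bqjDN (N : ℕ) (q t a b : ℝ) (c d : ℂ)
    (f : (Fin N → ℂ) → ℂ) (x : Fin N → ℂ) : ℂ :=
  ∑ i : Fin N,
    (bqjVandermonde N (Function.update x i ((t : ℂ) * x i)) / bqjVandermonde N x
        * bqjSigmaPlusN N q t a b c d (x i)
        * (f (Function.update x i ((q : ℂ) * x i)) - f x)
      + bqjVandermonde N (Function.update x i ((t : ℂ)⁻¹ * x i)) / bqjVandermonde N x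
        * bqjSigmaMinusN N q t a b (x i)
        * (f (Function.update x i ((q : ℂ)⁻¹ * x i)) - f x))

section PartialFractions

variable {ι K : Type*} [Field K] [DecidableEq ι]

/-- The Macdonald coefficient `∏_{j ∈ s, j ≠ i} (t x_i - x_j) / (x_i - x_j)`. -/
noncomputable def macdonaldCoeff (t : K) (x : ι → K) (s : Finset ι) (i : ι) : K :=
  ∏ j ∈ s.erase i, (t * x i - x j) / (x i - x j)

variable {t : K} {x : ι → K} {s : Finset ι}

lemma macdonaldCoeff_insert_self {k : ι} (hk : k ∉ s) :
    macdonaldCoeff t x (insert k s) k = ∏ j ∈ s, (t * x k - x j) / (x k - x j) := by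
  rw [macdonaldCoeff, Finset.erase_insert hk]

lemma macdonaldCoeff_insert_of_mem {i k : ι} (hk : k ∉ s) (hi : i ∈ s) :
    macdonaldCoeff t x (insert k s) i
      = (t * x i - x k) / (x i - x k) * macdonaldCoeff t x s i := by
  have hki : k ≠ i := fun h => hk (h ▸ hi)
  rw [macdonaldCoeff, Finset.erase_insert_of_ne hki, Finset.prod_insert (by simp [hk]),
    macdonaldCoeff]

lemma prod_div_eq_partialFractions (hx : Function.Injective x) (z : K) (hz : ∀ i ∈ s, z ≠ x i) :
    ∏ j ∈ s, (t * z - x j) / (z - x j)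
      = t ^ s.card + ∑ i ∈ s, (t - 1) * x i * macdonaldCoeff t x s i / (z - x i) := by
  induction s using Finset.induction_on generalizing z with
  | empty => simp
  | insert k s hk ih =>
    have hne : ∀ i ∈ s, x i ≠ x k := fun i hi h => hk (hx h ▸ hi)
    have hzk : z - x k ≠ 0 := sub_ne_zero.2 (hz k (by simp))
    rw [Finset.prod_insert hk, Finset.sum_insert hk, Finset.card_insert_of_notMem hk,
      macdonaldCoeff_insert_self hk, ih z fun i hi => hz i (by simp [hi]),
      ih (x k) fun i hi => (hne i hi).symm]
    have hterm : ∑ i ∈ s, (t - 1) * x i * macdonaldCoeff t x (insert k s) i / (z - x i)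
        = (t * z - x k) / (z - x k)
            * ∑ i ∈ s, (t - 1) * x i * macdonaldCoeff t x s i / (z - x i)
          - (t - 1) * x k / (z - x k)
            * ∑ i ∈ s, (t - 1) * x i * macdonaldCoeff t x s i / (x k - x i) := by
      rw [Finset.mul_sum, Finset.mul_sum, ← Finset.sum_sub_distrib]
      refine Finset.sum_congr rfl fun i hi => ?_
      rw [macdonaldCoeff_insert_of_mem hk hi]
      have h1 : x i - x k ≠ 0 := sub_ne_zero.2 (hne i hi)
      have h2 : x k - x i ≠ 0 := sub_ne_zero.2 (hne i hi).symm
      have h3 : z - x i ≠ 0 := sub_ne_zero.2 (hz i (by simp [hi]))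
      rw [← neg_sub (x i) (x k)]
      field_simp
      ring
    rw [hterm]
    field_simp
    ring

/-- Adding a point `k` to a weighted sum of Macdonald coefficients. -/
lemma sum_mul_macdonaldCoeff_insert (hx : Function.Injective x) {k : ι} (hk : k ∉ s)
    (g h : K → K)
    (hg : ∀ i ∈ s, g (x i) * (t * x i - x k) - (t - 1) * x i * g (x k)
      = h (x i) * (x i - x k)) :
    ∑ i ∈ insert k s, g (x i) * macdonaldCoeff t x (insert k s) i
      = g (x k) * t ^ s.card + ∑ i ∈ s, h (x i) * macdonaldCoeff t x s i := by
  have hne : ∀ i ∈ s, x i ≠ x k := fun i hi h => hk (hx h ▸ hi)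
  rw [Finset.sum_insert hk, macdonaldCoeff_insert_self hk,
    prod_div_eq_partialFractions hx _ fun i hi => (hne i hi).symm, mul_add, add_assoc,
    Finset.mul_sum, ← Finset.sum_add_distrib]
  congr 1
  refine Finset.sum_congr rfl fun i hi => ?_
  rw [macdonaldCoeff_insert_of_mem hk hi, ← neg_sub (x i) (x k)]
  have h1 : x i - x k ≠ 0 := sub_ne_zero.2 (hne i hi)
  field_simp
  linear_combination macdonaldCoeff t x s i * hg i hi

lemma sum_macdonaldCoeff (hx : Function.Injective x) :
    (t - 1) * ∑ i ∈ s, macdonaldCoeff t x s i = t ^ s.card - 1 := by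
  induction s using Finset.induction_on with
  | empty => simp
  | insert k s hk ih =>
    have := sum_mul_macdonaldCoeff_insert (t := t) hx hk (fun _ => 1) (fun _ => 1)
      (fun i _ => by ring)
    simp only [one_mul] at this
    rw [this, Finset.card_insert_of_notMem hk, mul_add, ih]
    ring

lemma sum_inv_mul_macdonaldCoeff (hx : Function.Injective x) (h0 : ∀ i, x i ≠ 0) :
    ∑ i ∈ s, (x i)⁻¹ * macdonaldCoeff t x s i = ∑ i ∈ s, (x i)⁻¹ := by
  induction s using Finset.induction_on with
  | empty => simp
  | insert k s hk ih =>
    rw [sum_mul_macdonaldCoeff_insert (t := t) hx hk (fun z => z⁻¹)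
      (fun z => z⁻¹ - (t - 1) * (x k)⁻¹), Finset.sum_insert hk, ← ih]
    · rw [Finset.sum_congr rfl fun i _ => sub_mul _ _ _, Finset.sum_sub_distrib,
        ← Finset.mul_sum]
      linear_combination -(x k)⁻¹ * sum_macdonaldCoeff (s := s) (t := t) hx
    · intro i _
      have := h0 i
      have := h0 k
      field_simp
      ring

lemma sum_mul_macdonaldCoeff (hx : Function.Injective x) :
    t * ∑ i ∈ s, x i * macdonaldCoeff t x s i = t ^ s.card * ∑ i ∈ s, x i := by
  induction s using Finset.induction_on with
  | empty => simp
  | insert k s hk ih =>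
    rw [sum_mul_macdonaldCoeff_insert (t := t) hx hk (fun z => z) (fun z => t * z)
      (fun i _ => by ring), Finset.sum_insert hk, Finset.card_insert_of_notMem hk]
    simp only [mul_assoc]
    rw [← Finset.mul_sum, mul_add, ih]
    ring

lemma sum_sq_mul_macdonaldCoeff (hx : Function.Injective x) :
    2 * t ^ 2 * ∑ i ∈ s, x i ^ 2 * macdonaldCoeff t x s i
      = t ^ s.card * (2 * t * (∑ i ∈ s, x i) ^ 2
        - (t + 1) * ((∑ i ∈ s, x i) ^ 2 - ∑ i ∈ s, x i ^ 2)) := by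
  induction s using Finset.induction_on with
  | empty => simp
  | insert k s hk ih =>
    rw [sum_mul_macdonaldCoeff_insert (t := t) hx hk (fun z => z ^ 2)
      (fun z => t * z ^ 2 + (t - 1) * x k * z)
      (fun i _ => by ring), Finset.sum_insert hk, Finset.sum_insert hk,
      Finset.card_insert_of_notMem hk]
    simp only [add_mul, Finset.sum_add_distrib]
    simp only [mul_assoc]
    rw [← Finset.mul_sum, ← Finset.mul_sum, ← Finset.mul_sum]
    linear_combination t * ih + 2 * t * (t - 1) * x k * sum_mul_macdonaldCoeff (s := s) (t := t) hx

end PartialFractions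

lemma two_mul_sum_sum_Ioi_mul {R : Type*} [CommRing R] (N : ℕ) (z : Fin N → R) :
    2 * ∑ i : Fin N, ∑ j ∈ Finset.Ioi i, z i * z j = (∑ i, z i) ^ 2 - ∑ i, z i ^ 2 := by
  have hswap : ∑ i : Fin N, ∑ j ∈ Finset.Iio i, z i * z j
      = ∑ i : Fin N, ∑ j ∈ Finset.Ioi i, z i * z j := by
    rw [Finset.sum_comm' (t' := Finset.univ) (s' := fun j => Finset.Ioi j) (by simp)]
    simp only [mul_comm]
  have hrow : ∀ i : Fin N, z i * ∑ j, z j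
      = z i ^ 2 + ∑ j ∈ Finset.Ioi i, z i * z j + ∑ j ∈ Finset.Iio i, z i * z j := by
    intro i
    have hU : (Finset.univ : Finset (Fin N)) = insert i (Finset.Ioi i ∪ Finset.Iio i) := by
      ext j
      have := lt_trichotomy i j
      simp only [Finset.mem_univ, Finset.mem_insert, Finset.mem_union, Finset.mem_Ioi,
        Finset.mem_Iio, true_iff]
      grind
    have hd : Disjoint (Finset.Ioi i) (Finset.Iio i) := by
      rw [Finset.disjoint_left]
      simp only [Finset.mem_Ioi, Finset.mem_Iio, not_lt]
      exact fun _ h => h.le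
    rw [hU, Finset.sum_insert (by simp), Finset.sum_union hd, mul_add, mul_add, Finset.mul_sum,
      Finset.mul_sum]
    ring
  rw [sq, Finset.sum_mul, Finset.sum_congr rfl fun i _ => hrow i, Finset.sum_add_distrib,
    Finset.sum_add_distrib, hswap]
  ring

lemma sum_sum_Ioi_mul_update_sub (N : ℕ) (x : Fin N → ℂ) (i : Fin N) (y : ℂ) :
    (∑ k : Fin N, ∑ j ∈ Finset.Ioi k, Function.update x i y k * Function.update x i y j)
        - ∑ k : Fin N, ∑ j ∈ Finset.Ioi k, x k * x j
      = (y - x i) * (∑ j, x j - x i) := by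
  have h1 := two_mul_sum_sum_Ioi_mul N (Function.update x i y)
  have h2 := two_mul_sum_sum_Ioi_mul N x
  have h3 : ∑ k, Function.update x i y k = y + (∑ k, x k - x i) := by
    rw [Finset.sum_update_of_mem (Finset.mem_univ i),
      ← Finset.add_sum_erase Finset.univ x (Finset.mem_univ i), Finset.sdiff_singleton_eq_erase]
    ring
  have h4 : ∑ k, Function.update x i y k ^ 2 = y ^ 2 + (∑ k, x k ^ 2 - x i ^ 2) := by
    rw [← Finset.add_sum_erase Finset.univ _ (Finset.mem_univ i),
      ← Finset.add_sum_erase Finset.univ (fun k => x k ^ 2) (Finset.mem_univ i),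
      Finset.sum_congr rfl fun k hk => by rw [Function.update_of_ne (Finset.ne_of_mem_erase hk)]]
    simp
  rw [h3, h4] at h1
  linear_combination (h1 - h2) / 2

lemma bqjVandermonde_update_div (N : ℕ) (x : Fin N → ℂ) (hx : Function.Injective x) (i : Fin N)
    (t : ℂ) :
    bqjVandermonde N (Function.update x i (t * x i)) / bqjVandermonde N x
      = macdonaldCoeff t x Finset.univ i := by
  set u := Function.update x i (t * x i) with hu
  have hui : u i = t * x i := by simp [hu]
  have huj : ∀ j, j ≠ i → u j = x j := fun j hj => by simp [hu, hj]
  have hne : ∀ a b, a ≠ b → x a - x b ≠ 0 := fun a b h => sub_ne_zero.2 (hx.ne h)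
  have hrow : ∀ a ∈ Finset.univ.erase i,
      ∏ b ∈ Finset.Ioi a, (u a - u b) / (x a - x b)
        = if a < i then (t * x i - x a) / (x i - x a) else 1 := by
    intro a ha
    have hai := Finset.ne_of_mem_erase ha
    have : ∀ b ∈ Finset.Ioi a, (u a - u b) / (x a - x b)
        = if b = i then (t * x i - x a) / (x i - x a) else 1 := by
      intro b hb
      split_ifs with h
      · subst h
        rw [hui, huj a hai, ← neg_sub (t * x b), ← neg_sub (x b), neg_div_neg_eq]
      · rw [huj a hai, huj b h, div_self (hne a b (Finset.mem_Ioi.1 hb).ne)]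
    rw [Finset.prod_congr rfl this, Finset.prod_ite_eq']
    simp
  have hcol : ∏ b ∈ Finset.Ioi i, (u i - u b) / (x i - x b)
      = ∏ b ∈ Finset.univ.erase i, if i < b then (t * x i - x b) / (x i - x b) else 1 := by
    rw [← Finset.prod_filter]
    refine Finset.prod_congr ?_ fun b hb => ?_
    · ext b
      simp only [Finset.mem_Ioi, Finset.mem_filter, Finset.mem_erase, Finset.mem_univ]
      exact ⟨fun h => ⟨⟨h.ne', trivial⟩, h⟩, fun h => h.2⟩
    · rw [Finset.mem_filter, Finset.mem_erase] at hb
      rw [hui, huj b hb.1.1]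
  simp only [bqjVandermonde]
  rw [← Finset.prod_div_distrib]
  simp only [← Finset.prod_div_distrib]
  rw [← Finset.mul_prod_erase _ _ (Finset.mem_univ i), Finset.prod_congr rfl hrow, hcol,
    ← Finset.prod_mul_distrib, macdonaldCoeff]
  refine Finset.prod_congr rfl fun j hj => ?_
  rcases lt_or_gt_of_ne (Finset.ne_of_mem_erase hj) with h | h
  · simp [h, h.le]
  · simp [h, h.le]

/-- Coefficient sums for one of the two shift directions of `D_N` acting on `e_2`. -/
lemma sum_macdonaldCoeff_mul_laurent (N : ℕ) (x : Fin N → ℂ) (hx : Function.Injective x)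
    (h0 : ∀ i, x i ≠ 0) (t : ℂ) (ht : t ≠ 0) (ht1 : t ≠ 1) (α β : ℂ) :
    ∑ i, macdonaldCoeff t x Finset.univ i
        * ((α - x⁻¹ i) * (β - x⁻¹ i) * (x i * (∑ j, x j - x i)))
      = α * β * ((t + 1) * t ^ N / (2 * t ^ 2)) * ((∑ i, x i) ^ 2 - ∑ i, x i ^ 2)
        - (α + β) * ((t ^ N - 1) / (t - 1) - t ^ N / t) * ∑ i, x i
        + ((∑ i, x i) * (∑ i, (x i)⁻¹) - (t ^ N - 1) / (t - 1)) := by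
  have ht' : t - 1 ≠ 0 := sub_ne_zero.2 ht1
  have s0 := sum_macdonaldCoeff (t := t) (s := Finset.univ) hx
  have s1 := sum_mul_macdonaldCoeff (t := t) (s := Finset.univ) hx
  have s2 := sum_sq_mul_macdonaldCoeff (t := t) (s := Finset.univ) hx
  have sm := sum_inv_mul_macdonaldCoeff (t := t) (s := Finset.univ) hx h0
  rw [Finset.card_univ, Fintype.card_fin] at s0 s1 s2
  set p := ∑ j, x j with hp
  have s0' := eq_div_of_mul_eq ht' ((mul_comm _ _).trans s0)
  have s1' := eq_div_of_mul_eq ht ((mul_comm _ _).trans s1)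
  have s2' := eq_div_of_mul_eq (by simpa using ht : 2 * t ^ 2 ≠ 0) ((mul_comm _ _).trans s2)
  have hterm : ∀ i, macdonaldCoeff t x Finset.univ i
        * ((α - x⁻¹ i) * (β - x⁻¹ i) * (x i * (p - x i)))
      = α * β * p * (x i * macdonaldCoeff t x Finset.univ i)
        - α * β * (x i ^ 2 * macdonaldCoeff t x Finset.univ i)
        - (α + β) * p * macdonaldCoeff t x Finset.univ i
        + (α + β) * (x i * macdonaldCoeff t x Finset.univ i)
        + p * ((x i)⁻¹ * macdonaldCoeff t x Finset.univ i)
        - macdonaldCoeff t x Finset.univ i := by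
    intro i
    have := h0 i
    rw [Pi.inv_apply]
    field_simp
    ring
  simp only [hterm, Finset.sum_add_distrib, Finset.sum_sub_distrib, ← Finset.mul_sum]
  rw [s0', s1', s2', sm]
  field_simp
  ring

/-- The constant term of `D_N e_{2,N}` equals `-C_N(q,t)(t^{1-N} - 1) < 0`, where
`C_N(q,t) = (q t^{N-1}/(a|b|))(1-q)(1-t^N)/(1-t)`. -/
theorem bqjDN_constant_term_e2
    (N : ℕ) (hN : 2 ≤ N) (q t a b : ℝ) (c d : ℂ)
    (hq : 0 < q) (hq1 : q < 1) (ht : 0 < t) (ht1 : t < 1)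
    (hb : b < 0) (ha : 0 < a) (hcd : c = starRingEnd ℂ d) (hc : c.im ≠ 0) :
    ∃ P : MvPolynomial (Fin N) ℝ,
      (∀ x : Fin N → ℝ, (∀ i, x i ≠ 0) → (∀ i j, i ≠ j → x i ≠ x j) →
        bqjDN N q t a b c d
            (fun z => ∑ i : Fin N, ∑ j ∈ Finset.Ioi i, z i * z j) (fun i => (x i : ℂ))
          = ((MvPolynomial.eval x P : ℝ) : ℂ)) ∧
      MvPolynomial.coeff 0 P
        = -(q * t ^ ((N : ℤ) - 1) / (a * |b|) * (1 - q) * (1 - t ^ N) / (1 - t))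
            * (t ^ ((1 : ℤ) - N) - 1) ∧
      MvPolynomial.coeff 0 P < 0 := by
  set C₀ : ℝ := -(q * t ^ ((N : ℤ) - 1) / (a * |b|) * (1 - q) * (1 - t ^ N) / (1 - t))
            * (t ^ ((1 : ℤ) - N) - 1) with hC₀
  set κ : ℝ := t ^ ((N : ℤ) - 1) * (q / (a * b)) * (1 - q) with hκ
  set A : ℝ → ℝ := fun s => (s + 1) * s ^ N / (2 * s ^ 2) with hA
  set B : ℝ → ℝ := fun s => (s ^ N - 1) / (s - 1) - s ^ N / s with hB
  set p₁ : MvPolynomial (Fin N) ℝ := ∑ i, MvPolynomial.X i with hp₁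
  set p₂ : MvPolynomial (Fin N) ℝ := ∑ i, MvPolynomial.X i ^ 2 with hp₂
  set P : MvPolynomial (Fin N) ℝ := MvPolynomial.C C₀
    + MvPolynomial.C (κ * (Complex.normSq d * A t - a / q * (b / q) * A t⁻¹)) * (p₁ ^ 2 - p₂)
    - MvPolynomial.C (κ * (2 * d.re * B t - (a / q + b / q) * B t⁻¹)) * p₁ with hP
  have hcoeff : MvPolynomial.coeff 0 P = C₀ := by
    change MvPolynomial.constantCoeff P = C₀
    simp [hP, hp₁, hp₂]
  have htinv : 1 < t⁻¹ := (one_lt_inv₀ ht).2 ht1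
  refine ⟨P, fun x h0 hx => ?_, hcoeff, ?_⟩
  · set y : Fin N → ℂ := fun i => (x i : ℂ) with hy
    have hyinj : Function.Injective y := fun i j h => by
      by_contra hij
      exact hx i j hij (by simpa [hy] using h)
    have hy0 : ∀ i, y i ≠ 0 := fun i => by simpa [hy] using h0 i
    have htC : (t : ℂ) ≠ 0 := by exact_mod_cast ht.ne'
    have ht1C : (t : ℂ) ≠ 1 := by exact_mod_cast ht1.ne
    have htiC : (t : ℂ)⁻¹ ≠ 1 := by simpa using ht1C
    have hqC : (q : ℂ) ≠ 0 := by exact_mod_cast hq.ne'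
    have haC : (a : ℂ) ≠ 0 := by exact_mod_cast ha.ne'
    have hbC : (b : ℂ) ≠ 0 := by exact_mod_cast hb.ne
    have hplus := sum_macdonaldCoeff_mul_laurent N y hyinj hy0 t htC ht1C c d
    have hminus := sum_macdonaldCoeff_mul_laurent N y hyinj hy0 (t : ℂ)⁻¹ (inv_ne_zero htC) htiC
      (a / q) (b / q)
    have hD : bqjDN N q t a b c d
        (fun z => ∑ i : Fin N, ∑ j ∈ Finset.Ioi i, z i * z j) y
        = κ * (∑ i, macdonaldCoeff (t : ℂ) y Finset.univ i
              * ((c - y⁻¹ i) * (d - y⁻¹ i) * (y i * (∑ j, y j - y i)))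
            - ∑ i, macdonaldCoeff (t : ℂ)⁻¹ y Finset.univ i
              * (((a : ℂ) / q - y⁻¹ i) * ((b : ℂ) / q - y⁻¹ i) * (y i * (∑ j, y j - y i)))) := by
      rw [bqjDN, ← Finset.sum_sub_distrib, Finset.mul_sum]
      refine Finset.sum_congr rfl fun i _ => ?_
      rw [bqjVandermonde_update_div N y hyinj, bqjVandermonde_update_div N y hyinj,
        sum_sum_Ioi_mul_update_sub, sum_sum_Ioi_mul_update_sub, bqjSigmaPlusN, bqjSigmaMinusN,
        hκ, Pi.inv_apply]
      push_cast
      generalize (y i)⁻¹ = w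
      generalize (t : ℂ) ^ ((N : ℤ) - 1) = T
      field_simp
      ring
    have hsum : c + d = ((2 * d.re : ℝ) : ℂ) := by
      rw [hcd, add_comm, Complex.add_conj]
    have hprod : c * d = ((Complex.normSq d : ℝ) : ℂ) := by
      rw [hcd, mul_comm, Complex.mul_conj]
    have hC : C₀ = κ * ((t⁻¹ ^ N - 1) / (t⁻¹ - 1) - (t ^ N - 1) / (t - 1)) := by
      have ht' : 1 - t ≠ 0 := by linarith
      have hN1 : t ^ ((1 : ℤ) - N) = t * t⁻¹ ^ N := by
        rw [zpow_sub₀ ht.ne', zpow_one, zpow_natCast, inv_pow, div_eq_mul_inv]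
      have h3 : (t⁻¹ ^ N - 1) / (t⁻¹ - 1) = (1 - t ^ N) / (1 - t) * (t * t⁻¹ ^ N) := by
        have : t⁻¹ - 1 ≠ 0 := by linarith
        rw [inv_pow]
        have := ht.ne'
        field_simp
      have h4 : (t ^ N - 1) / (t - 1) = (1 - t ^ N) / (1 - t) := by
        rw [← neg_sub 1 (t ^ N), ← neg_sub 1 t, neg_div_neg_eq]
      rw [hC₀, hκ, h3, h4, hN1, abs_of_neg hb]
      have := hb.ne
      have := ha.ne'
      generalize t ^ ((N : ℤ) - 1) = T
      generalize t⁻¹ ^ N = U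
      field_simp
    rw [hD, hplus, hminus, hsum, hprod, hP, hC]
    simp only [map_add, map_sub, map_mul, map_pow, MvPolynomial.eval_C, hp₁, hp₂, map_sum,
      MvPolynomial.eval_X, hA, hB, hy]
    push_cast
    ring
  · rw [hcoeff, hC₀]
    have h1 : 1 < t ^ ((1 : ℤ) - N) := one_lt_zpow_of_neg₀ ht ht1 (by omega)
    have h2 : t ^ N < 1 := pow_lt_one₀ ht.le ht1 (by omega)
    have h3 : 0 < t ^ ((N : ℤ) - 1) := zpow_pos ht _
    have h4 : 0 < |b| := abs_pos.2 hb.ne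
    have h5 : 0 < 1 - q := by linarith
    have h6 : 0 < 1 - t ^ N := by linarith
    have h7 : 0 < 1 - t := by linarith
    rw [neg_mul, neg_lt_zero]
    exact mul_pos (by positivity) (by linarith)
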